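/- Let F be a dyadic local field with e = ord(2) and Δ a unit with quadratic defect 4𝒪_F. Let M ≅ ≺a₁,…,a_m≻ be an integral 𝒪_F-lattice relative to a good BONG with R_i = ord(a_i). If R_j = -2e for some even j ≤ m-1 and R_{j+1} is even, then [a₁,…,a_{j+1}] ≅ ℍ^{j/2} ⊥ [ε] for some unit ε with ε ∈ a_{j+1}F^{×2} ∪ Δa_{j+1}F^{×2}. -/

import Mathlib

noncomputable section
open scoped Classical

/-- A normalized discrete valuation on a field, written additively with values in `ℤ ∪ {∞}`. -/
structure NormDiscValuation (F : Type*) [Field F] : Type _ where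
  v : F → WithTop ℤ
  v_zero : v 0 = ⊤
  v_ne_top : ∀ x : F, x ≠ 0 → v x ≠ ⊤
  v_mul : ∀ x y : F, v (x * y) = v x + v y
  v_add : ∀ x y : F, min (v x) (v y) ≤ v (x + y)
  v_surj : ∀ k : ℤ, ∃ x : F, v x = (k : WithTop ℤ)

variable {F : Type*}

/-- The order of the relative quadratic defect: `d(c) = ord (c⁻¹ 𝔡(c))`, where
`𝔡(c) = ⋂_{x ∈ F} (c - x²) 𝒪_F`; the order of this intersection of principal fractional
ideals is the supremum of the orders `ord ((c - x²)/c)`. -/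
def relDefect [Field F] (V : NormDiscValuation F) (c : F) : WithTop ℤ :=
  ⨆ x : F, V.v ((c - x ^ 2) / c)

/-- `(a, b)_𝔭 = 1` for the Hilbert symbol: `z² = a x² + b y²` has a nontrivial solution. -/
def HilbertOne [Field F] (a b : F) : Prop := ∃ x y : F, a * x ^ 2 + b * y ^ 2 = 1

/-- The diagonal quadratic space `[w 0, …, w (n-1)]`. -/
def diagQF [Field F] (n : ℕ) (w : Fin n → F) : QuadraticMap F (Fin n → F) F :=
  QuadraticMap.weightedSumSquares F w

/-- `Q'` is represented by `Q`: there is an injective isometry from `Q'` into `Q`. -/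
def QRep [Field F] {n k : ℕ} (Q : QuadraticMap F (Fin n → F) F)
    (Q' : QuadraticMap F (Fin k → F) F) : Prop :=
  ∃ f : Q' →qᵢ Q, Function.Injective f

/-- Weights of the diagonal space `ℍ^{(n-l)/2} ⊥ [t₁,…,t_l]`, where `l` is the length of
the list `tail` (each hyperbolic plane being `[1,-1]`). -/
def padDiag [Field F] (n : ℕ) (tail : List F) : Fin n → F := fun i =>
  if (i : ℕ) < n - tail.length then (if (i : ℕ) % 2 = 0 then 1 else -1)
  else tail.getD ((i : ℕ) - (n - tail.length)) 0

namespace NormDiscValuation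

section Basic

variable [Field F] (V : NormDiscValuation F)

theorem v_one : V.v 1 = 0 := by
  have h := V.v_mul 1 1
  rw [mul_one] at h
  lift V.v 1 to ℤ using V.v_ne_top 1 one_ne_zero with k
  norm_cast at h ⊢
  omega

/-- The valuation as a bundled `AddValuation`. -/
def toAddValuation : AddValuation F (WithTop ℤ) :=
  AddValuation.of V.v V.v_zero V.v_one V.v_add V.v_mul

theorem v_pow (x : F) (n : ℕ) : V.v (x ^ n) = n • V.v x :=
  V.toAddValuation.map_pow x n

theorem v_neg (x : F) : V.v (-x) = V.v x :=
  V.toAddValuation.map_neg x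

theorem v_inv_of_eq {x : F} {k : ℤ} (hx : V.v x = k) : V.v x⁻¹ = (-k : ℤ) := by
  have hx0 : x ≠ 0 := by
    rintro rfl
    rw [V.v_zero] at hx
    exact WithTop.top_ne_coe hx
  have h := V.v_mul x x⁻¹
  rw [mul_inv_cancel₀ hx0, V.v_one, hx] at h
  lift V.v x⁻¹ to ℤ using V.v_ne_top _ (inv_ne_zero hx0) with l
  norm_cast at h ⊢
  omega

theorem exists_v_eq {x : F} (hx : x ≠ 0) : ∃ k : ℤ, V.v x = k :=
  ⟨(V.v x).untop (V.v_ne_top x hx), (WithTop.coe_untop _ _).symm⟩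

/-- The ring of integers of a normalized discrete valuation. -/
def integers : ValuationSubring F where
  carrier := {x | 0 ≤ V.v x}
  mul_mem' {x y} hx hy := by
    change 0 ≤ V.v (x * y)
    rw [V.v_mul]
    exact add_nonneg hx hy
  one_mem' := V.v_one.ge
  add_mem' {x y} hx hy := (le_min hx hy).trans (V.v_add x y)
  zero_mem' := by simp [V.v_zero]
  neg_mem' {x} hx := by
    change 0 ≤ V.v (-x)
    rwa [V.v_neg]
  mem_or_inv_mem' x := by
    change 0 ≤ V.v x ∨ 0 ≤ V.v x⁻¹
    rcases eq_or_ne x 0 with rfl | hx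
    · simp [V.v_zero]
    obtain ⟨k, hk⟩ := V.exists_v_eq hx
    rw [hk, V.v_inv_of_eq hk]
    norm_cast
    omega

theorem isUnit_integers_iff (x : V.integers) : IsUnit x ↔ V.v x = 0 := by
  constructor
  · rintro ⟨u, rfl⟩
    have h : (u : F) * ((u⁻¹ : V.integersˣ) : V.integers) = 1 := by
      rw [← MulMemClass.coe_mul, Units.mul_inv]
      rfl
    have h' := V.v_mul (u : F) ((u⁻¹ : V.integersˣ) : V.integers)
    rw [h, V.v_one] at h'
    refine le_antisymm ?_ (u : V.integers).2
    calc V.v u ≤ V.v u + V.v ((u⁻¹ : V.integersˣ) : V.integers) :=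
          le_add_of_nonneg_right ((u⁻¹ : V.integersˣ) : V.integers).2
      _ = 0 := h'.symm
  · intro h
    have hx : (x : F) ≠ 0 := by
      intro h0
      rw [h0, V.v_zero] at h
      exact WithTop.top_ne_zero h
    have hinv : V.v (x : F)⁻¹ = 0 := by
      simpa using V.v_inv_of_eq (k := 0) (by simpa using h)
    exact IsUnit.of_mul_eq_one ⟨(x : F)⁻¹, hinv.ge⟩ (Subtype.ext (mul_inv_cancel₀ hx))

theorem residue_eq_zero_iff (x : V.integers) :
    IsLocalRing.residue V.integers x = 0 ↔ 0 < V.v x := by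
  rw [IsLocalRing.residue_eq_zero_iff, IsLocalRing.mem_maximalIdeal, mem_nonunits_iff,
    isUnit_integers_iff, lt_iff_le_and_ne, ne_comm]
  exact (and_iff_right x.2).symm

theorem v_two_nonneg : 0 ≤ V.v 2 := by
  have := V.v_add 1 1
  rwa [V.v_one, min_self, one_add_one_eq_two] at this

end Basic

theorem exists_pow_three_eq {u : ℤ_[2]} (hu : IsUnit u) : ∃ y : ℤ_[2], IsUnit y ∧ y ^ 3 = u := by
  have h3 : ‖(3 : ℤ_[2])‖ = 1 := by
    have := PadicInt.norm_intCast_eq_one_iff (p := 2) (z := 3)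
    simpa using this.2 (by decide)
  have hlt : ∀ a : ℤ_[2], IsUnit a → ‖a - 1‖ < 1 := fun a ha ↦ by
    have h := (PadicInt.toZMod (p := 2)).isUnit_map ha
    have h1 : PadicInt.toZMod (a - 1) = 0 := by
      rw [map_sub, map_one]
      generalize PadicInt.toZMod a = b at h
      revert b
      decide
    rw [← RingHom.mem_ker, PadicInt.ker_toZMod, IsLocalRing.mem_maximalIdeal,
      PadicInt.mem_nonunits] at h1
    exact h1
  obtain ⟨z, hz, -⟩ := hensels_lemma (F := (Polynomial.X ^ 3 - Polynomial.C u))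
    (a := (1 : ℤ_[2])) (by
      simp only [map_sub, map_pow, Polynomial.aeval_X, Polynomial.aeval_C,
        Polynomial.derivative_X_pow, Polynomial.derivative_C]
      simp [h3]
      rw [← norm_neg, neg_sub]
      exact hlt u hu)
  have hz' : z ^ 3 = u := by simpa [sub_eq_zero] using hz
  refine ⟨z, ?_, hz'⟩
  rw [← hz'] at hu
  exact (isUnit_pow_iff three_ne_zero).1 hu

end NormDiscValuation

namespace NormDiscValuation

section Padic

variable [Field F] [Algebra ℚ_[2] F] (V : NormDiscValuation F)

theorem v_algebraMap_unit {u : ℤ_[2]} (hu : IsUnit u) :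
    V.v (algebraMap ℚ_[2] F u) = 0 := by
  have hne : ∀ {u : ℤ_[2]}, IsUnit u → algebraMap ℚ_[2] F u ≠ 0 := fun hu h0 ↦ by
    rw [map_eq_zero, PadicInt.coe_eq_zero] at h0
    exact hu.ne_zero h0
  suffices ∀ (n : ℕ) (u : ℤ_[2]), IsUnit u → ∀ k : ℤ, V.v (algebraMap ℚ_[2] F u) = k →
      k.natAbs = n → k = 0 by
    obtain ⟨k, hk⟩ := V.exists_v_eq (hne hu)
    rw [hk, this _ u hu k hk rfl]
    rfl
  intro n
  induction n using Nat.strong_induction_on with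
  | _ n ih =>
    intro u hu k hk hn
    obtain ⟨y, hy, rfl⟩ := exists_pow_three_eq hu
    obtain ⟨l, hl⟩ := V.exists_v_eq (hne hy)
    rw [PadicInt.coe_pow, map_pow, V.v_pow, hl] at hk
    have hkl : k = 3 * l := by
      have : ((3 • l : ℤ) : WithTop ℤ) = k := by rw [← hk]; rfl
      norm_cast at this
      simpa using this.symm
    by_contra h0
    exact h0 (by rw [hkl, ih l.natAbs (by omega) y hy l hl rfl, mul_zero])

theorem v_algebraMap_nonneg (x : ℤ_[2]) : 0 ≤ V.v (algebraMap ℚ_[2] F x) := by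
  rcases eq_or_ne x 0 with rfl | hx
  · simp [V.v_zero]
  rw [PadicInt.unitCoeff_spec hx, PadicInt.coe_mul, map_mul, V.v_mul,
    V.v_algebraMap_unit (Units.isUnit _), zero_add]
  simp only [PadicInt.coe_pow, map_pow, V.v_pow, Nat.cast_ofNat]
  have : (((2 : ℤ_[2]) : ℚ_[2])) = 2 := rfl
  rw [this, map_ofNat]
  exact nsmul_nonneg V.v_two_nonneg _

theorem algebraMap_mem_integers (x : ℤ_[2]) : algebraMap ℚ_[2] F x ∈ V.integers :=
  V.v_algebraMap_nonneg x

/-- The inclusion of the `2`-adic integers in the ring of integers of `V`. -/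
def ofPadicInt : ℤ_[2] →+* V.integers :=
  ((algebraMap ℚ_[2] F).comp PadicInt.Coe.ringHom).codRestrict V.integers.toSubring
    V.algebraMap_mem_integers

theorem two_ne_zero_of_algebra {F : Type*} [Field F] [Algebra ℚ_[2] F] : (2 : F) ≠ 0 := by
  rw [← map_ofNat (algebraMap ℚ_[2] F) 2]
  exact (map_ne_zero _).2 two_ne_zero

theorem spectralNorm_two : spectralNorm ℚ_[2] F 2 = 2⁻¹ := by
  rw [← map_ofNat (algebraMap ℚ_[2] F) 2, spectralNorm_extends]
  exact_mod_cast Padic.norm_p (p := 2)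

variable [FiniteDimensional ℚ_[2] F]

theorem exists_monic_of_spectralNorm_le_one {x : F} (hx : spectralNorm ℚ_[2] F x ≤ 1) :
    ∃ p : Polynomial ℤ_[2], p.Monic ∧
      p.eval₂ ((algebraMap ℚ_[2] F).comp PadicInt.Coe.ringHom) x = 0 := by
  have hint : IsIntegral ℚ_[2] x := Algebra.IsIntegral.isIntegral x
  have hm := minpoly.monic hint
  have hc := (spectralValue_le_one_iff hm).1 hx
  have hl : minpoly ℚ_[2] x ∈ Polynomial.lifts (PadicInt.Coe.ringHom (p := 2)) :=
    (Polynomial.lifts_iff_coeff_lifts _).2 fun n ↦ ⟨⟨_, hc n⟩, rfl⟩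
  obtain ⟨q, hq, -, hqm⟩ := Polynomial.lifts_and_degree_eq_and_monic hl hm
  refine ⟨q, hqm, ?_⟩
  rw [← Polynomial.eval₂_map, hq]
  exact minpoly.aeval _ _

theorem nonneg_of_spectralNorm_le_one {x : F} (hx : spectralNorm ℚ_[2] F x ≤ 1) :
    0 ≤ V.v x := by
  obtain ⟨p, hp, hpx⟩ := exists_monic_of_spectralNorm_le_one hx
  have : IsIntegral V.integers x := by
    refine ⟨p.map V.ofPadicInt, hp.map _, ?_⟩
    rw [Polynomial.eval₂_map]
    exact hpx
  obtain ⟨y, rfl⟩ := IsIntegrallyClosed.isIntegral_iff.1 this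
  exact y.2

theorem spectralNorm_mul_eq {K : Type*} [Field K] [Algebra ℚ_[2] K]
    [Algebra.IsAlgebraic ℚ_[2] K] (x y : K) :
    spectralNorm ℚ_[2] K (x * y) = spectralNorm ℚ_[2] K x * spectralNorm ℚ_[2] K y :=
  map_mul (spectralMulAlgNorm ℚ_[2] K) x y

theorem spectralNorm_pow_eq {K : Type*} [Field K] [Algebra ℚ_[2] K]
    [Algebra.IsAlgebraic ℚ_[2] K] (x : K) (n : ℕ) :
    spectralNorm ℚ_[2] K (x ^ n) = spectralNorm ℚ_[2] K x ^ n :=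
  map_pow (spectralMulAlgNorm ℚ_[2] K) x n

theorem spectralNorm_inv_eq {x : F} (hx : x ≠ 0) :
    spectralNorm ℚ_[2] F x⁻¹ = (spectralNorm ℚ_[2] F x)⁻¹ := by
  refine eq_inv_of_mul_eq_one_left ?_
  rw [← spectralNorm_mul_eq, inv_mul_cancel₀ hx, spectralNorm_one]

theorem spectralNorm_lt_one {x : F} (hx : 0 < V.v x) : spectralNorm ℚ_[2] F x < 1 := by
  by_contra! h
  rcases eq_or_ne x 0 with rfl | hx0
  · rw [spectralNorm_zero] at h
    norm_num at h
  have h' : spectralNorm ℚ_[2] F x⁻¹ ≤ 1 := by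
    rw [spectralNorm_inv_eq hx0]
    exact inv_le_one_of_one_le₀ h
  have h2 := V.nonneg_of_spectralNorm_le_one h'
  obtain ⟨k, hk⟩ := V.exists_v_eq hx0
  rw [V.v_inv_of_eq hk] at h2
  rw [hk] at hx
  norm_cast at h2 hx
  omega

theorem v_two_pos : 0 < V.v 2 := by
  refine V.v_two_nonneg.lt_of_ne fun h0 ↦ ?_
  obtain ⟨x, hx⟩ := V.v_surj (-1)
  obtain ⟨n, hn⟩ := pow_unbounded_of_one_lt (spectralNorm ℚ_[2] F x) one_lt_two
  have h : spectralNorm ℚ_[2] F (2 ^ n * x) ≤ 1 := by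
    rw [spectralNorm_mul_eq, spectralNorm_pow_eq, spectralNorm_two, inv_pow]
    exact inv_mul_le_one_of_le₀ hn.le (by positivity)
  have h2 := V.nonneg_of_spectralNorm_le_one h
  rw [V.v_mul, V.v_pow, ← h0, smul_zero, zero_add, hx] at h2
  norm_cast at h2

theorem spectralNorm_le_one {x : F} (hx : 0 ≤ V.v x) : spectralNorm ℚ_[2] F x ≤ 1 := by
  by_contra! h
  have hx0 : x ≠ 0 := by
    rintro rfl
    rw [spectralNorm_zero] at h
    norm_num at h
  have h20 : (2 : F) ≠ 0 := two_ne_zero_of_algebra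
  obtain ⟨n, hn⟩ := pow_unbounded_of_one_lt 2 h
  have hle : spectralNorm ℚ_[2] F ((x ^ n)⁻¹ * 2⁻¹) ≤ 1 := by
    rw [← mul_inv, spectralNorm_inv_eq (mul_ne_zero (pow_ne_zero n hx0) h20),
      spectralNorm_mul_eq, spectralNorm_pow_eq, spectralNorm_two]
    refine inv_le_one_of_one_le₀ ?_
    linarith
  have h1 := V.nonneg_of_spectralNorm_le_one hle
  obtain ⟨k, hk⟩ := V.exists_v_eq (pow_ne_zero n hx0)
  obtain ⟨e, he⟩ := V.exists_v_eq h20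
  have h2 := V.v_two_pos
  have h3 : 0 ≤ V.v (x ^ n) := by rw [V.v_pow]; exact nsmul_nonneg hx n
  rw [hk] at h3
  rw [he] at h2
  rw [V.v_mul, V.v_inv_of_eq hk, V.v_inv_of_eq he] at h1
  norm_cast at h1 h2 h3
  omega

/-- Hensel's lemma for `X ^ 2 + X - θ`, through the uniqueness of the norm extension. -/
theorem exists_sq_add_eq {θ : F} (hθ : 0 < V.v θ) : ∃ z : F, z ^ 2 + z = θ := by
  by_contra! hroot
  set P : Polynomial F := Polynomial.X ^ 2 + Polynomial.X - Polynomial.C θ with hP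
  have hPd : P.natDegree = 2 := by
    rw [hP]; compute_degree!
  have hPm : P.Monic := by
    rw [hP]; monicity!
  have hirr : Irreducible P := by
    refine Polynomial.irreducible_of_degree_le_three_of_not_isRoot
      (by rw [Finset.mem_Icc]; omega) fun x hx ↦ hroot x ?_
    simpa [hP, sub_eq_zero] using hx
  let K := AlgebraicClosure F
  have : Algebra.IsAlgebraic ℚ_[2] K := Algebra.IsAlgebraic.trans ℚ_[2] F K
  obtain ⟨α, hα⟩ := IsAlgClosed.exists_aeval_eq_zero K P (by
    rw [Polynomial.degree_eq_natDegree hPm.ne_zero, hPd]; decide)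
  have hα' : α ^ 2 + α = algebraMap F K θ := by
    simpa [hP, sub_eq_zero] using hα
  have hβ : Polynomial.aeval (-1 - α) P = 0 := by
    simp only [hP, map_sub, map_add, map_pow, Polynomial.aeval_X, Polynomial.aeval_C, ← hα']
    ring
  have hdvd : P ∣ (minpoly ℚ_[2] α).map (algebraMap ℚ_[2] F) := by
    rw [minpoly.eq_of_irreducible_of_monic hirr hα hPm]
    exact minpoly.dvd _ _ (by rw [Polynomial.aeval_map_algebraMap, minpoly.aeval])
  have hmin : minpoly ℚ_[2] α = minpoly ℚ_[2] (-1 - α) := by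
    refine minpoly.eq_of_irreducible_of_monic
      (minpoly.irreducible (Algebra.IsIntegral.isIntegral α)) ?_
      (minpoly.monic (Algebra.IsIntegral.isIntegral α))
    rw [← Polynomial.aeval_map_algebraMap F]
    exact Polynomial.aeval_eq_zero_of_dvd_aeval_eq_zero hdvd hβ
  have hN : spectralNorm ℚ_[2] K α = spectralNorm ℚ_[2] K (-1 - α) := by
    rw [spectralNorm, spectralNorm, hmin]
  have hprod : spectralNorm ℚ_[2] K α * spectralNorm ℚ_[2] K (-1 - α) < 1 := by
    rw [← spectralNorm_mul_eq, show α * (-1 - α) = algebraMap F K (-θ) by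
      rw [map_neg, ← hα']; ring, ← spectralNorm.eq_of_tower]
    exact V.spectralNorm_lt_one (by rwa [V.v_neg])
  have hα1 : spectralNorm ℚ_[2] K α < 1 := by
    rw [← hN, ← sq] at hprod
    exact (sq_lt_one_iff₀ (spectralNorm_nonneg _)).1 hprod
  have hsum := isNonarchimedean_spectralNorm (K := ℚ_[2]) (L := K) α (-1 - α)
  rw [← hN, max_self, show α + (-1 - α) = -1 by ring,
    spectralNorm_neg (Algebra.IsAlgebraic.isAlgebraic _), spectralNorm_one] at hsum
  linarith

end Padic

end NormDiscValuation

section CharTwo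

variable {K : Type*} [Field K] [Algebra (ZMod 2) K] [Algebra.IsIntegral (ZMod 2) K]

theorem exists_sq_eq_of_isIntegral_zmod_two (a : K) : ∃ s : K, s ^ 2 = a := by
  have := charP_of_injective_algebraMap (algebraMap (ZMod 2) K).injective 2
  have := Algebra.IsAlgebraic.perfectField (ZMod 2) (L := K)
  have := PerfectField.toPerfectRing (K := K) 2
  exact (bijective_frobenius K 2).2 a

/-- The Artin–Schreier map of a finite field of characteristic two has image of index two. -/
theorem exists_sq_add_eq_add_of_finite {E : Type*} [Field E] [Finite E] [CharP E 2] {a b : E}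
    (ha : ∀ z, z ^ 2 + z ≠ a) (hb : ∀ z, z ^ 2 + z ≠ b) : ∃ z, z ^ 2 + z = a + b := by
  let f : E →+ E :=
    { toFun := fun z ↦ z ^ 2 + z
      map_zero' := by simp
      map_add' := fun x y ↦ by rw [CharTwo.add_sq]; ring }
  have hker : (f.ker : Set E) = {0, 1} := by
    ext z
    simp only [SetLike.mem_coe, AddMonoidHom.mem_ker, Set.mem_insert_iff, Set.mem_singleton_iff]
    change z ^ 2 + z = 0 ↔ _
    rw [show z ^ 2 + z = z * (z + 1) by ring, mul_eq_zero, CharTwo.add_eq_zero]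
  have hcard : Nat.card f.ker = 2 := by
    rw [← SetLike.coe_sort_coe, hker, Nat.card_coe_set_eq, Set.ncard_pair zero_ne_one]
  have hidx : f.range.index = 2 := by
    have h1 := f.range.card_mul_index
    have h2 := f.ker.card_mul_index
    rw [AddSubgroup.index_ker, hcard, ← h1, mul_comm] at h2
    exact (Nat.eq_of_mul_eq_mul_left Nat.card_pos h2).symm
  exact (AddSubgroup.add_mem_iff_of_index_two hidx).2
    (iff_of_false (fun ⟨z, hz⟩ ↦ ha z hz) fun ⟨z, hz⟩ ↦ hb z hz)

theorem exists_sq_add_eq_add_of_isIntegral {a b : K}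
    (ha : ∀ z, z ^ 2 + z ≠ a) (hb : ∀ z, z ^ 2 + z ≠ b) : ∃ z, z ^ 2 + z = a + b := by
  let E := IntermediateField.adjoin (ZMod 2) {a, b}
  have : FiniteDimensional (ZMod 2) E := IntermediateField.finiteDimensional_adjoin_pair
    (Algebra.IsIntegral.isIntegral a) (Algebra.IsIntegral.isIntegral b)
  have : Finite E := Module.finite_of_finite (ZMod 2)
  have := charP_of_injective_algebraMap (algebraMap (ZMod 2) E).injective 2
  obtain ⟨z, hz⟩ := exists_sq_add_eq_add_of_finite (E := E)
    (a := ⟨a, IntermediateField.subset_adjoin _ _ (by simp)⟩)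
    (b := ⟨b, IntermediateField.subset_adjoin _ _ (by simp)⟩)
    (fun z h ↦ ha z (congrArg Subtype.val h)) (fun z h ↦ hb z (congrArg Subtype.val h))
  exact ⟨z, congrArg Subtype.val hz⟩

end CharTwo

namespace NormDiscValuation

section Residue

variable [Field F] [Algebra ℚ_[2] F] [FiniteDimensional ℚ_[2] F] (V : NormDiscValuation F)

theorem residue_two : IsLocalRing.residue V.integers 2 = 0 :=
  (V.residue_eq_zero_iff 2).2 V.v_two_pos

theorem charP_residueField : CharP (IsLocalRing.ResidueField V.integers) 2 :=
  CharTwo.of_one_ne_zero_of_two_eq_zero one_ne_zero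
    (by rw [← map_ofNat (IsLocalRing.residue V.integers) 2]; exact V.residue_two)

theorem residue_comp_ofPadicInt [Algebra (ZMod 2) (IsLocalRing.ResidueField V.integers)] :
    (IsLocalRing.residue V.integers).comp V.ofPadicInt =
      (algebraMap (ZMod 2) (IsLocalRing.ResidueField V.integers)).comp PadicInt.toZMod := by
  ext x
  have hmem : x - ((PadicInt.toZMod x).val : ℤ_[2]) ∈
      RingHom.ker (PadicInt.toZMod (p := 2)) := by
    rw [RingHom.mem_ker, map_sub, map_natCast, ZMod.natCast_zmod_val, sub_self]
  rw [PadicInt.ker_toZMod, PadicInt.maximalIdeal_eq_span_p, Ideal.mem_span_singleton] at hmem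
  obtain ⟨y, hy⟩ := hmem
  have h0 : IsLocalRing.residue V.integers
      (V.ofPadicInt (x - ((PadicInt.toZMod x).val : ℤ_[2]))) = 0 := by
    rw [hy, map_mul, map_mul, map_natCast, Nat.cast_ofNat, V.residue_two, zero_mul]
  rw [map_sub, map_sub, sub_eq_zero, map_natCast, map_natCast] at h0
  rw [RingHom.comp_apply, RingHom.comp_apply, h0]
  conv_rhs => rw [← ZMod.natCast_zmod_val (PadicInt.toZMod x), map_natCast]

theorem isIntegral_residueField [Algebra (ZMod 2) (IsLocalRing.ResidueField V.integers)] :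
    Algebra.IsIntegral (ZMod 2) (IsLocalRing.ResidueField V.integers) := by
  refine ⟨fun x ↦ ?_⟩
  obtain ⟨y, rfl⟩ := IsLocalRing.residue_surjective x
  obtain ⟨p, hp, hpy⟩ := exists_monic_of_spectralNorm_le_one (V.spectralNorm_le_one y.2)
  refine ⟨p.map PadicInt.toZMod, hp.map _, ?_⟩
  have h : p.eval₂ V.ofPadicInt y = 0 := by
    apply Subtype.val_injective
    change V.integers.subtype _ = _
    rw [Polynomial.hom_eval₂]
    exact hpy
  rw [Polynomial.eval₂_map, ← V.residue_comp_ofPadicInt, ← Polynomial.hom_eval₂, h, map_zero]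

theorem exists_quadratic_root {A B C : F} (hA : 0 ≤ V.v A) (hB : V.v B = 0) (hC : 0 < V.v C) :
    ∃ z : F, A * z ^ 2 + B * z + C = 0 := by
  have hB0 : B ≠ 0 := by
    rintro rfl
    rw [V.v_zero] at hB
    exact WithTop.top_ne_zero hB
  rcases eq_or_ne A 0 with rfl | hA0
  · exact ⟨-C / B, by field_simp; ring⟩
  have hBinv : V.v (B⁻¹ ^ 2) = 0 := by
    rw [V.v_pow, V.v_inv_of_eq (k := 0) (by simpa using hB)]
    simp
  obtain ⟨w, hw⟩ := V.exists_sq_add_eq (θ := -(A * C) * B⁻¹ ^ 2) (by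
    rw [V.v_mul, V.v_neg, V.v_mul, hBinv, add_zero]
    exact hC.trans_le (le_add_of_nonneg_left hA))
  refine ⟨B * w / A, ?_⟩
  have h : A * (B * w / A) ^ 2 + B * (B * w / A) + C = B ^ 2 / A * (w ^ 2 + w) + C := by
    field_simp
  rw [h, hw]
  field_simp
  ring

theorem isSquare_of_residue {τ : V.integers} {s : IsLocalRing.ResidueField V.integers}
    (hs : s ^ 2 + s = IsLocalRing.residue V.integers τ) : IsSquare (1 + 4 * (τ : F)) := by
  obtain ⟨z, rfl⟩ := IsLocalRing.residue_surjective s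
  have hB : V.v (1 + 2 * z : V.integers) = 0 := by
    rw [← isUnit_integers_iff, ← IsLocalRing.residue_ne_zero_iff_isUnit, map_add, map_mul,
      residue_two, zero_mul, add_zero, map_one]
    exact one_ne_zero
  have hC : 0 < V.v (z ^ 2 + z - τ : V.integers) := by
    rw [← residue_eq_zero_iff, map_sub, map_add, map_pow, hs, sub_self]
  obtain ⟨w, hw⟩ := V.exists_quadratic_root V.v_one.ge hB hC
  refine ⟨1 + 2 * (z + w), ?_⟩
  push_cast at hw
  have h2 : ((2 : V.integers) : F) = 2 := rfl
  rw [h2] at hw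
  linear_combination -4 * hw

/-- Units `1 + 4ρ`, modulo squares, form a group with at most two elements. -/
theorem isSquare_or_isSquare_mul {ρ σ : V.integers} (hρ : ¬ IsSquare (1 + 4 * (ρ : F))) :
    IsSquare (1 + 4 * (σ : F)) ∨ IsSquare ((1 + 4 * (ρ : F)) * (1 + 4 * (σ : F))) := by
  have := V.charP_residueField
  let := ZMod.algebra (IsLocalRing.ResidueField V.integers) 2
  have := V.isIntegral_residueField
  by_contra! h
  obtain ⟨z, hz⟩ := exists_sq_add_eq_add_of_isIntegral
    (fun z hz ↦ hρ (V.isSquare_of_residue (s := z) hz))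
    (fun z hz ↦ h.1 (V.isSquare_of_residue (s := z) hz))
  have h4 : IsLocalRing.residue V.integers (4 * (ρ * σ)) = 0 := by
    rw [show (4 : V.integers) = 2 * 2 by norm_num, mul_assoc, map_mul, residue_two, zero_mul]
  refine h.2 ?_
  convert V.isSquare_of_residue (τ := ρ + σ + 4 * (ρ * σ)) (s := z)
    (by rw [hz, map_add, h4, add_zero, map_add]) using 1
  push_cast
  have h4' : ((4 : V.integers) : F) = 4 := rfl
  rw [h4']
  ring

/-- Units are norms from the unramified extension `F(√(1 + 4ρ))`. -/
theorem exists_sq_sub_mul_sq (ρ : V.integers) {u : F} (hu : V.v u = 0) :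
    ∃ x y : F, x ^ 2 - (1 + 4 * (ρ : F)) * y ^ 2 = u := by
  have := V.charP_residueField
  let := ZMod.algebra (IsLocalRing.ResidueField V.integers) 2
  have := V.isIntegral_residueField
  let u' : V.integers := ⟨u, hu.ge⟩
  have hu' : IsLocalRing.residue V.integers u' ≠ 0 :=
    (IsLocalRing.residue_ne_zero_iff_isUnit _).2 ((V.isUnit_integers_iff u').2 hu)
  obtain ⟨s', hs'⟩ := exists_sq_eq_of_isIntegral_zmod_two (IsLocalRing.residue V.integers u')
  obtain ⟨s, rfl⟩ := IsLocalRing.residue_surjective s'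
  have hs : V.v s = 0 := by
    rw [← isUnit_integers_iff, ← IsLocalRing.residue_ne_zero_iff_isUnit]
    intro h
    rw [h] at hs'
    exact hu' (by rw [← hs']; simp)
  have hC : 0 < V.v (s ^ 2 - u' : V.integers) := by
    rw [← residue_eq_zero_iff, map_sub, map_pow, hs', sub_self]
  obtain ⟨z, hz⟩ := V.exists_quadratic_root (-ρ).2 hs hC
  have h2 : (2 : F) ≠ 0 := two_ne_zero_of_algebra
  refine ⟨s + z / 2, z / 2, ?_⟩
  push_cast at hz
  field_simp
  linear_combination 4 * hz

end Residue

end NormDiscValuation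

namespace NormDiscValuation

section Defect

variable [Field F] (V : NormDiscValuation F)

theorem isLUB_relDefect (c : F) :
    IsLUB (Set.range fun x ↦ V.v ((c - x ^ 2) / c)) (relDefect V c) :=
  WithTop.isLUB_sSup' (Set.range_nonempty _)

theorem exists_le_of_le_relDefect {c : F} {k : ℤ} (h : k ≤ relDefect V c) :
    ∃ x, k ≤ V.v ((c - x ^ 2) / c) := by
  by_contra! hlt
  have hle : relDefect V c ≤ ((k - 1 : ℤ) : WithTop ℤ) := by
    refine (V.isLUB_relDefect c).2 ?_
    rintro _ ⟨x, rfl⟩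
    have hx := hlt x
    dsimp only
    lift V.v ((c - x ^ 2) / c) to ℤ using hx.ne_top with l
    norm_cast at hx ⊢
    omega
  have := h.trans hle
  norm_cast at this
  omega

theorem not_isSquare_of_relDefect_eq {c : F} {k : ℤ} (h : relDefect V c = k) :
    ¬ IsSquare c := by
  rintro ⟨x, hx⟩
  have hle : V.v ((c - x ^ 2) / c) ≤ relDefect V c := (V.isLUB_relDefect c).1 ⟨x, rfl⟩
  rw [hx, sq, sub_self, zero_div, V.v_zero, ← hx, h] at hle
  exact WithTop.coe_ne_top (top_le_iff.1 hle)

variable [Algebra ℚ_[2] F] [FiniteDimensional ℚ_[2] F] {e : ℤ}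

theorem exists_eq_sq_mul_one_add (he : V.v 2 = e) {c : F} (hc : c ≠ 0)
    (h : ((2 * e : ℤ) : WithTop ℤ) ≤ relDefect V c) :
    ∃ x : F, x ≠ 0 ∧ ∃ σ : V.integers, c = x ^ 2 * (1 + 4 * σ) := by
  obtain ⟨x, hx⟩ := V.exists_le_of_le_relDefect h
  have he0 : 0 < e := by
    have := V.v_two_pos
    rw [he] at this
    exact_mod_cast this
  have h2 : (2 : F) ≠ 0 := two_ne_zero_of_algebra
  set w := (c - x ^ 2) / c with hw
  have hxw : x ^ 2 = c * (1 - w) := by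
    rw [hw]
    field_simp
    ring
  have hwpos : 0 < V.v w := by
    refine lt_of_lt_of_le ?_ hx
    norm_cast
    omega
  have h1w : V.v (1 - w) = 0 := by
    let w' : V.integers := ⟨w, hwpos.le⟩
    change V.v (1 - w' : V.integers) = 0
    rw [← isUnit_integers_iff, ← IsLocalRing.residue_ne_zero_iff_isUnit, map_sub,
      (V.residue_eq_zero_iff w').2 hwpos, map_one, sub_zero]
    exact one_ne_zero
  have h1w0 : 1 - w ≠ 0 := by
    intro h0
    rw [h0, V.v_zero] at h1w
    exact WithTop.top_ne_zero h1w
  have hσ : 0 ≤ V.v (w * (2⁻¹ * 2⁻¹) * (1 - w)⁻¹) := by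
    rw [V.v_mul, V.v_mul, V.v_mul, V.v_inv_of_eq he,
      V.v_inv_of_eq (k := 0) (by simpa using h1w)]
    rcases eq_or_ne w 0 with h0 | h0
    · simp [h0, V.v_zero]
    · obtain ⟨l, hl⟩ := V.exists_v_eq h0
      rw [hl] at hx ⊢
      norm_cast at hx ⊢
      omega
  refine ⟨x, fun h0 ↦ mul_ne_zero hc h1w0 (by rw [← hxw, h0]; ring), ⟨_, hσ⟩, ?_⟩
  rw [hxw]
  field_simp
  ring

theorem exists_eq_sq_or_eq_mul_sq (he : V.v 2 = e) {Δ : F} (hΔ : V.v Δ = 0)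
    (hΔd : relDefect V Δ = ((2 * e : ℤ) : WithTop ℤ)) {c : F} (hc : c ≠ 0)
    (h : ((2 * e : ℤ) : WithTop ℤ) ≤ relDefect V c) :
    ∃ t : F, t ≠ 0 ∧ (c = t ^ 2 ∨ c = Δ * t ^ 2) := by
  have hΔ0 : Δ ≠ 0 := by
    rintro rfl
    rw [V.v_zero] at hΔ
    exact WithTop.top_ne_zero hΔ
  obtain ⟨x, hx, ρ, hρ⟩ := V.exists_eq_sq_mul_one_add he hΔ0 hΔd.ge
  obtain ⟨y, hy, σ, hσ⟩ := V.exists_eq_sq_mul_one_add he hc h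
  have hns : ¬ IsSquare (1 + 4 * (ρ : F)) := fun ⟨r, hr⟩ ↦
    V.not_isSquare_of_relDefect_eq hΔd ⟨x * r, by rw [hρ, hr]; ring⟩
  have hσ0 : 1 + 4 * (σ : F) ≠ 0 := fun h0 ↦ hc (by rw [hσ, h0, mul_zero])
  have hρ0 : 1 + 4 * (ρ : F) ≠ 0 := fun h0 ↦ hΔ0 (by rw [hρ, h0, mul_zero])
  rcases V.isSquare_or_isSquare_mul (σ := σ) hns with ⟨r, hr⟩ | ⟨r, hr⟩
  · have hr0 : r ≠ 0 := by
      rintro rfl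
      exact hσ0 (by rw [hr, zero_mul])
    exact ⟨y * r, mul_ne_zero hy hr0, .inl (by rw [hσ, hr]; ring)⟩
  · have hr0 : r ≠ 0 := by
      rintro rfl
      exact mul_ne_zero hρ0 hσ0 (by rw [hr, zero_mul])
    refine ⟨y * r / (x * (1 + 4 * ρ)), by positivity, .inr ?_⟩
    rw [hσ, hρ]
    field_simp
    linear_combination hr

theorem exists_mul_sq_add_mul_sq_eq (he : V.v 2 = e) {a b u : F} (ha : V.v a = 0) (hb : b ≠ 0)
    (hu : V.v u = 0) (h : ((2 * e : ℤ) : WithTop ℤ) ≤ relDefect V (-(a * b))) :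
    ∃ x y : F, a * x ^ 2 + b * y ^ 2 = u := by
  have ha0 : a ≠ 0 := by
    rintro rfl
    rw [V.v_zero] at ha
    exact WithTop.top_ne_zero ha
  obtain ⟨t, ht, σ, hσ⟩ :=
    V.exists_eq_sq_mul_one_add he (neg_ne_zero.2 (mul_ne_zero ha0 hb)) h
  obtain ⟨x, y, hxy⟩ := V.exists_sq_sub_mul_sq σ (u := u * a⁻¹) (by
    rw [V.v_mul, hu, V.v_inv_of_eq (k := 0) (by simpa using ha)]
    simp)
  refine ⟨x, a * y / t, ?_⟩
  rw [eq_mul_inv_iff_mul_eq₀ ha0] at hxy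
  field_simp
  linear_combination t ^ 2 * hxy - a * y ^ 2 * hσ

end Defect

end NormDiscValuation

section DiagonalForms

open QuadraticMap

variable [Field F] {ι : Type*} [Fintype ι] [DecidableEq ι]

/-- Replacing the binary part `[w p, w q]` of a diagonal form by an isometric one. -/
theorem equivalent_weightedSumSquares_of_binary {w w' : ι → F} {p q : ι} (hpq : p ≠ q)
    (x y : F) {s : F} (hs : s ≠ 0) (hp0 : w' p ≠ 0) (hp : w' p = w p * x ^ 2 + w q * y ^ 2)
    (hq : w' q = w p * w q * w' p * s ^ 2) (hw : ∀ i, i ≠ p → i ≠ q → w' i = w i) :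
    (weightedSumSquares F w).Equivalent (weightedSumSquares F w') := by
  let f : (ι → F) ≃ₗ[F] (ι → F) :=
    { toFun := fun z i ↦ if i = p then x * z p - w q * y * s * z q
        else if i = q then y * z p + w p * x * s * z q else z i
      map_add' := fun z z' ↦ by
        ext i
        simp only [Pi.add_apply]
        split_ifs <;> ring
      map_smul' := fun c z ↦ by
        ext i
        simp only [Pi.smul_apply, smul_eq_mul, RingHom.id_apply]
        split_ifs <;> ring
      invFun := fun z i ↦ if i = p then (w p * x * z p + w q * y * z q) / w' p
        else if i = q then (x * z q - y * z p) / (w' p * s) else z i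
      left_inv := fun z ↦ by
        ext i
        simp only [if_true, if_neg hpq.symm]
        split_ifs with h1 h2
        · subst h1; field_simp; rw [hp]; ring
        · subst h2; field_simp; rw [hp]; ring
        · rfl
      right_inv := fun z ↦ by
        ext i
        simp only [if_true, if_neg hpq.symm]
        split_ifs with h1 h2
        · subst h1; field_simp; rw [hp]; ring
        · subst h2; field_simp; rw [hp]; ring
        · rfl }
  refine Equivalent.symm ⟨⟨f, fun z ↦ ?_⟩⟩
  change weightedSumSquares F w (f z) = _
  have hfp : f z p = x * z p - w q * y * s * z q := if_pos rfl
  have hfq : f z q = y * z p + w p * x * s * z q := by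
    simp [f, hpq.symm]
  have hf : ∀ i, i ≠ p → i ≠ q → f z i = z i := fun i h1 h2 ↦ by
    simp [f, h1, h2]
  have hsplit : ∀ g : ι → F,
      ∑ i, g i = g p + (g q + ∑ i ∈ (Finset.univ.erase p).erase q, g i) := fun g ↦ by
    rw [Finset.add_sum_erase _ _ (by simp [hpq.symm]), Finset.add_sum_erase _ _ (by simp)]
  rw [weightedSumSquares_apply, weightedSumSquares_apply, hsplit, hsplit, hfp, hfq, hq,
    Finset.sum_congr rfl (g := fun i ↦ w' i • (z i * z i)) fun i hi ↦ by
      simp only [Finset.mem_erase, Finset.mem_univ, and_true] at hi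
      rw [hf i hi.2 hi.1, hw i hi.2 hi.1]]
  simp only [smul_eq_mul, hp]
  ring

/-- If `[w p, w q]` represents `-w r`, then a hyperbolic plane splits off `[w p, w q, w r]`. -/
theorem equivalent_weightedSumSquares_of_ternary {w w' : ι → F} {p q r : ι} (hpq : p ≠ q)
    (hpr : p ≠ r) (hqr : q ≠ r) (h2 : (2 : F) ≠ 0) {x y s : F} (hs : s ≠ 0) (hp0 : w p ≠ 0)
    (hq0 : w q ≠ 0) (hr0 : w r ≠ 0) (hxy : w p * x ^ 2 + w q * y ^ 2 = -w r)
    (hp : w' p = 1) (hq : w' q = -1) (hr : w' r = -(w p * w q) * w r * s ^ 2)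
    (hw : ∀ i, i ≠ p → i ≠ q → i ≠ r → w' i = w i) :
    (weightedSumSquares F w).Equivalent (weightedSumSquares F w') := by
  let w₁ : ι → F := Function.update (Function.update w p (-w r)) q (w' r)
  have h1p : w₁ p = -w r := by simp [w₁, hpq]
  have h1q : w₁ q = w' r := by simp [w₁]
  have h1r : w₁ r = w r := by simp [w₁, hpr.symm, hqr.symm]
  have h1 : ∀ i, i ≠ p → i ≠ q → w₁ i = w i := fun i hip hiq ↦ by simp [w₁, hip, hiq]
  let w₂ : ι → F := Function.update (Function.update w₁ p 1) r (-1)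
  have h2p : w₂ p = 1 := by simp [w₂, hpr]
  have h2q : w₂ q = w' r := by simp [w₂, hpq.symm, hqr, h1q]
  have h2r : w₂ r = -1 := by simp [w₂]
  have h2i : ∀ i, i ≠ p → i ≠ r → w₂ i = w₁ i := fun i hip hir ↦ by simp [w₂, hip, hir]
  have hr'0 : w' r ≠ 0 := by
    rw [hr]
    exact mul_ne_zero (mul_ne_zero (neg_ne_zero.2 (mul_ne_zero hp0 hq0)) hr0) (pow_ne_zero 2 hs)
  refine (equivalent_weightedSumSquares_of_binary (w' := w₁) hpq x y hs
    (by rw [h1p]; exact neg_ne_zero.2 hr0) (by rw [h1p, hxy]) (by rw [h1p, h1q, hr]; ring) h1).trans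
    ((equivalent_weightedSumSquares_of_binary (w' := w₂) hpr (((w r)⁻¹ - 1) / 2)
      (((w r)⁻¹ + 1) / 2) (inv_ne_zero hr0) (by rw [h2p]; exact one_ne_zero) ?_ ?_ h2i).trans
    (equivalent_weightedSumSquares_of_binary (w' := w') hqr 0 1 (s := 1)
      one_ne_zero (by rw [hq]; exact neg_ne_zero.2 one_ne_zero) ?_ ?_ ?_))
  · rw [h2p, h1p, h1r]
    field_simp
    ring
  · rw [h2p, h2r, h1p, h1r]
    field_simp
  · rw [h2r, hq]
    ring
  · rw [h2r, h2q, hq]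
    ring
  · intro i hiq hir
    by_cases hip : i = p
    · rw [hip, h2p, hp]
    · rw [h2i i hip hir, h1 i hip hiq, hw i hip hiq hir]

end DiagonalForms

/-- for an integral lattice with good BONG, if `R_j = -2e` for an even
`j ≤ m - 1` and `R_{j+1}` is even, then `[a₁,…,a_{j+1}] ≅ ℍ^{j/2} ⊥ [ε]` for some unit
`ε` in the square class of `a_{j+1}` or `Δ a_{j+1}`. -/
theorem bong_space_hyperbolic_unit [Field F] [Algebra ℚ_[2] F]
    [FiniteDimensional ℚ_[2] F]
    (V : NormDiscValuation F) (e : ℤ) (he : V.v 2 = (e : WithTop ℤ))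
    (m : ℕ) (a : ℕ → F) (R : ℕ → ℤ)
    (hne : ∀ i, 1 ≤ i → i ≤ m → a i ≠ 0)
    (hval : ∀ i, 1 ≤ i → i ≤ m → V.v (a i) = (R i : WithTop ℤ))
    (hgood : ∀ i, 1 ≤ i → i + 2 ≤ m → R i ≤ R (i + 2))
    (hbong₁ : ∀ i, 1 ≤ i → i + 1 ≤ m →
      (0 : WithTop ℤ) ≤ ((R (i + 1) - R i : ℤ) : WithTop ℤ)
        + relDefect V (-(a i * a (i + 1))))
    (hbong₂ : ∀ i, 1 ≤ i → i + 1 ≤ m → -(2 * e) ≤ R (i + 1) - R i)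
    (hint : 0 ≤ R 1)
    (Δ : F) (hΔu : V.v Δ = (0 : WithTop ℤ))
    (hΔd : relDefect V Δ = ((2 * e : ℤ) : WithTop ℤ))
    (j : ℕ) (hjeven : Even j) (hj1 : 1 ≤ j) (hjm1 : j + 1 ≤ m) (hRj : R j = -(2 * e))
    (hRj1 : Even (R (j + 1))) :
    ∃ ε : F, V.v ε = (0 : WithTop ℤ) ∧
      (∃ t : F, t ≠ 0 ∧ (ε = a (j + 1) * t ^ 2 ∨ ε = Δ * a (j + 1) * t ^ 2)) ∧
      QuadraticMap.Equivalent (diagQF (j + 1) (fun i : Fin (j + 1) => a ((i : ℕ) + 1)))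
        (diagQF (j + 1) (padDiag (j + 1) [ε])) := by
  obtain ⟨k, hk⟩ := hjeven.exists_two_nsmul
  obtain rfl : j = 2 * k := by simpa using hk
  have h2 : (2 : F) ≠ 0 := NormDiscValuation.two_ne_zero_of_algebra
  have hΔ0 : Δ ≠ 0 := by
    rintro rfl
    rw [V.v_zero] at hΔu
    exact WithTop.top_ne_zero hΔu
  have hodd : ∀ i, 2 * i + 1 ≤ m → 0 ≤ R (2 * i + 1) := by
    intro i
    induction i with
    | zero => exact fun _ ↦ hint
    | succ i ih => exact fun h ↦ (ih (by omega)).trans (hgood (2 * i + 1) (by omega) (by omega))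
  have hev : ∀ d i, i + 1 + d = k → R (2 * i + 2) ≤ -(2 * e) := by
    intro d
    induction d with
    | zero =>
      rintro i rfl
      exact hRj.le
    | succ d ih =>
      exact fun i hi ↦ (hgood (2 * i + 2) (by omega) (by omega)).trans (ih (i + 1) (by omega))
  have hR : ∀ i < k, R (2 * i + 1) = 0 ∧ R (2 * i + 2) = -(2 * e) := fun i hi ↦ by
    have h1 := hodd i (by omega)
    have h3 := hev (k - i - 1) i (by omega)
    have h4 := hbong₂ (2 * i + 1) (by omega) (by omega)
    rw [show 2 * i + 1 + 1 = 2 * i + 2 from rfl] at h4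
    omega
  have key : ∀ s ≤ k, ∃ η : F, V.v η = 0 ∧
      (∃ t : F, t ≠ 0 ∧ (η = a (2 * k + 1) * t ^ 2 ∨ η = Δ * a (2 * k + 1) * t ^ 2)) ∧
      QuadraticMap.Equivalent (diagQF (2 * k + 1) (fun i : Fin (2 * k + 1) => a ((i : ℕ) + 1)))
        (diagQF (2 * k + 1) fun i : Fin (2 * k + 1) ↦
          if (i : ℕ) < 2 * s then (if (i : ℕ) % 2 = 0 then 1 else -1)
          else if (i : ℕ) = 2 * k then η else a ((i : ℕ) + 1)) := by
    intro s
    induction s with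
    | zero =>
      intro _
      obtain ⟨l, hl⟩ := hRj1
      obtain ⟨t, ht⟩ := V.v_surj (-l)
      have ht0 : t ≠ 0 := by
        rintro rfl
        rw [V.v_zero] at ht
        exact WithTop.top_ne_coe ht
      refine ⟨a (2 * k + 1) * t ^ 2, ?_, ⟨t, ht0, .inl rfl⟩, ?_⟩
      · rw [V.v_mul, sq, V.v_mul, ht, hval _ (by omega) hjm1, hl]
        norm_cast
        omega
      · have ha1 := hne 1 le_rfl (by omega)
        refine equivalent_weightedSumSquares_of_binary (p := ⟨0, by omega⟩)
          (q := ⟨2 * k, by omega⟩) (by simp; omega) 1 0 (s := t / a 1) (by positivity) ?_ ?_ ?_ ?_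
        · rw [if_neg (by simp), if_neg (by simp; omega)]
          exact ha1
        · rw [if_neg (by simp), if_neg (by simp; omega)]
          ring
        · rw [if_neg (by simp), if_pos rfl, if_neg (by simp), if_neg (by simp; omega)]
          simp only [zero_add]
          field_simp
        · intro i _ hi
          rw [if_neg (by simp), if_neg fun h ↦ hi (Fin.ext h)]
    | succ s ih =>
      intro hs
      obtain ⟨η, hη, ⟨t, ht, hηt⟩, hequiv⟩ := ih (by omega)
      have hη0 : η ≠ 0 := by
        rintro rfl
        rw [V.v_zero] at hη
        exact WithTop.top_ne_zero hη
      obtain ⟨hR1, hR2⟩ := hR s (by omega)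
      have ha1 := hne (2 * s + 1) (by omega) (by omega)
      have ha2 := hne (2 * s + 2) (by omega) (by omega)
      have hv1 : V.v (a (2 * s + 1)) = 0 := by
        rw [hval _ (by omega) (by omega), hR1]
        rfl
      have hd : ((2 * e : ℤ) : WithTop ℤ) ≤ relDefect V (-(a (2 * s + 1) * a (2 * s + 2))) := by
        have h := hbong₁ (2 * s + 1) (by omega) (by omega)
        rw [show 2 * s + 1 + 1 = 2 * s + 2 from rfl, hR1, hR2] at h
        generalize relDefect V (-(a (2 * s + 1) * a (2 * s + 2))) = d at h ⊢
        cases d with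
        | top => exact le_top
        | coe d =>
          norm_cast at h ⊢
          omega
      obtain ⟨x, y, hxy⟩ := V.exists_mul_sq_add_mul_sq_eq he hv1 ha2
        (u := -η) (by rw [V.v_neg, hη]) hd
      obtain ⟨τ, hτ, hδ⟩ := V.exists_eq_sq_or_eq_mul_sq he hΔu hΔd
        (neg_ne_zero.2 (mul_ne_zero ha1 ha2)) hd
      obtain ⟨δ, hδv, hδτ, hδt⟩ : ∃ δ : F, V.v δ = 0 ∧
          δ = -(a (2 * s + 1) * a (2 * s + 2)) * τ⁻¹ ^ 2 ∧ ∃ t : F, t ≠ 0 ∧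
            (δ * η = a (2 * k + 1) * t ^ 2 ∨ δ * η = Δ * a (2 * k + 1) * t ^ 2) := by
        rcases hδ with h | h
        · refine ⟨1, V.v_one, by rw [h]; field_simp, t, ht, by simpa using hηt⟩
        · refine ⟨Δ, hΔu, by rw [h]; field_simp, ?_⟩
          rcases hηt with rfl | rfl
          · exact ⟨t, ht, .inr (by ring)⟩
          · exact ⟨Δ * t, mul_ne_zero hΔ0 ht, .inl (by ring)⟩
      refine ⟨δ * η, by rw [V.v_mul, hδv, hη, add_zero], hδt, hequiv.trans ?_⟩
      refine equivalent_weightedSumSquares_of_ternary (p := ⟨2 * s, by omega⟩)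
        (q := ⟨2 * s + 1, by omega⟩) (r := ⟨2 * k, by omega⟩) (by simp) (by simp; omega)
        (by simp; omega) h2 (x := x) (y := y) (inv_ne_zero hτ) ?_ ?_ ?_ ?_ ?_ ?_ ?_ ?_
      any_goals dsimp only
      · rwa [if_neg (by omega), if_neg (by omega)]
      · rwa [if_neg (by omega), if_neg (by omega)]
      · rwa [if_neg (by omega), if_pos rfl]
      · rwa [if_neg (by omega), if_neg (by omega), if_neg (by omega), if_neg (by omega),
          if_neg (by omega), if_pos rfl]
      · rw [if_pos (by omega), if_pos (by omega)]
      · rw [if_pos (by omega), if_neg (by omega)]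
      · rw [if_neg (by omega), if_pos rfl, if_neg (by omega), if_neg (by omega),
          if_neg (by omega), if_neg (by omega), if_neg (by omega), if_pos rfl, hδτ]
        ring
      · intro i hp hq hr
        rw [Ne, Fin.ext_iff] at hp hq hr
        dsimp only at hp hq hr
        by_cases hi : (i : ℕ) < 2 * s
        · rw [if_pos hi, if_pos (by omega)]
        · rw [if_neg hi, if_neg (by omega), if_neg hr, if_neg hr]
  obtain ⟨η, hη, hηt, hequiv⟩ := key k le_rfl
  refine ⟨η, hη, hηt, ?_⟩
  convert hequiv using 2
  ext i
  simp only [padDiag, List.length_singleton, Nat.add_sub_cancel]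
  split_ifs with h1 _ h3
  · rfl
  · rfl
  · simp [h3]
  · omega
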